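/- arXiv:2605.28614 — 2 statements merged into one kernel-verified Lean document; each statement's English description precedes it below -/
import Mathlib

section
/- Fix real numbers A ≠ 0, D > 0, and s2 ≥ s1 ≥ max(0, −4A/D). Then as Δ → ∞, Σ_{sqrt(s1·Δ) < n ≤ sqrt(s2·Δ)} φ(n)·sqrt(D + 4AΔ/n^2) = (3Δ/π^2)·[ sqrt(D·u^2 + 4A·u) + (4A/sqrt(D))·log( sqrt(D·u) + sqrt(D·u + 4A) ) ] evaluated from u = s1 to u = s2, plus an error O(sqrt(Δ)·(log Δ)^2). -/
open Real Finset

/-- A sum over factorizations `n = d * m` with `n ≤ N`, reordered by the first factor. -/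
theorem sum_Ioc_sum_divisorsAntidiagonal (F : ℕ → ℕ → ℝ) (N : ℕ) :
    ∑ n ∈ Ioc 0 N, ∑ x ∈ n.divisorsAntidiagonal, F x.1 x.2 =
      ∑ d ∈ Ioc 0 N, ∑ m ∈ Ioc 0 (N / d), F d m := by
  rw [sum_sigma', sum_sigma']
  refine sum_bij' (fun x _ => ⟨x.2.1, x.2.2⟩) (fun y _ => ⟨y.1 * y.2, (y.1, y.2)⟩) ?_ ?_ ?_ ?_ ?_
  · rintro ⟨n, d, m⟩ h
    simp only [mem_sigma, mem_Ioc, Nat.mem_divisorsAntidiagonal] at h ⊢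
    obtain ⟨⟨hn, hN⟩, rfl, -⟩ := h
    have hd : 0 < d := Nat.pos_of_mul_pos_right hn
    have hm : 0 < m := Nat.pos_of_mul_pos_left hn
    exact ⟨⟨hd, (Nat.le_mul_of_pos_right d hm).trans hN⟩, hm,
      (Nat.le_div_iff_mul_le hd).2 (by rwa [mul_comm])⟩
  · rintro ⟨d, m⟩ h
    simp only [mem_sigma, mem_Ioc, Nat.mem_divisorsAntidiagonal] at h ⊢
    obtain ⟨⟨hd, -⟩, hm, hmN⟩ := h
    have := (Nat.le_div_iff_mul_le hd).1 hmN
    exact ⟨⟨Nat.mul_pos hd hm, by rwa [mul_comm]⟩, trivial, (Nat.mul_pos hd hm).ne'⟩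
  · rintro ⟨n, d, m⟩ h
    simp only [mem_sigma, mem_Ioc, Nat.mem_divisorsAntidiagonal] at h
    obtain ⟨-, rfl, -⟩ := h
    rfl
  · rintro ⟨d, m⟩ _
    rfl
  · rintro ⟨n, d, m⟩ _
    rfl

theorem totient_eq_sum_moebius_mul {n : ℕ} (hn : 0 < n) :
    (Nat.totient n : ℝ) =
      ∑ x ∈ n.divisorsAntidiagonal, (ArithmeticFunction.moebius x.1 : ℝ) * x.2 :=
  ((ArithmeticFunction.sum_eq_iff_sum_mul_moebius_eq (R := ℝ)
    (f := fun n => (Nat.totient n : ℝ)) (g := fun n => (n : ℝ))).1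
    (fun n _ => by exact_mod_cast Nat.sum_totient n) n hn).symm

theorem hasSum_moebius_div_sq :
    HasSum (fun d : ℕ => (ArithmeticFunction.moebius d : ℝ) / (d : ℝ) ^ 2) (6 / π ^ 2) := by
  have h2 : (1 : ℝ) < (2 : ℂ).re := by norm_num
  have hs := (ArithmeticFunction.LSeriesSummable_moebius_iff.2 h2).hasSum
  have hmul := ArithmeticFunction.LSeries_zeta_mul_Lseries_moebius h2
  rw [ArithmeticFunction.LSeries_zeta_eq_riemannZeta h2, riemannZeta_two] at hmul
  have hval : LSeries (fun n => ((ArithmeticFunction.moebius n : ℤ) : ℂ)) 2 =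
      ((6 / π ^ 2 : ℝ) : ℂ) := by
    have hpi : (π : ℂ) ≠ 0 := by exact_mod_cast pi_ne_zero
    push_cast
    field_simp at hmul ⊢
    linear_combination hmul
  rw [← Complex.hasSum_ofReal, ← hval]
  convert! hs using 1
  ext d
  rcases eq_or_ne d 0 with rfl | hd
  · simp
  · rw [LSeries.term_of_ne_zero hd]
    norm_cast

/-- Tail bound for the series `∑ μ(d)/d² = 6/π²`. -/
theorem abs_sum_Ioc_moebius_div_sq_sub_le (N : ℕ) :
    |∑ d ∈ Ioc 0 N, (ArithmeticFunction.moebius d : ℝ) / (d : ℝ) ^ 2 - 6 / π ^ 2| ≤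
      2 / ((N : ℝ) + 1) := by
  set a : ℕ → ℝ := fun d => (ArithmeticFunction.moebius d : ℝ) / (d : ℝ) ^ 2 with ha
  have hle (d : ℕ) : |a d| ≤ ((d : ℝ) ^ 2)⁻¹ := by
    rw [ha, abs_div, abs_of_nonneg (sq_nonneg (d : ℝ)), ← one_div]
    gcongr
    exact_mod_cast ArithmeticFunction.abs_moebius_le_one
  have hlim := (hasSum_moebius_div_sq.tendsto_sum_nat.const_sub (∑ d ∈ Ioc 0 N, a d)).abs
  refine le_of_tendsto hlim ?_
  filter_upwards [Filter.eventually_gt_atTop N] with n hn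
  have hsplit : ∑ d ∈ range n, a d = ∑ d ∈ Ioc 0 N, a d + ∑ d ∈ Ioo N n, a d := by
    rw [← sum_union (by
      rw [disjoint_left]; intro x; simp only [mem_Ioc, mem_Ioo]; omega)]
    symm
    apply sum_subset
    · intro x; simp only [mem_union, mem_Ioc, mem_Ioo, mem_range]; omega
    · intro x hx hx'
      have : x = 0 := by
        simp only [mem_union, mem_Ioc, mem_Ioo, mem_range] at hx hx'; omega
      simp [ha, this]
  rw [hsplit, sub_add_cancel_left, abs_neg]
  exact (abs_sum_le_sum_abs _ _).trans
    ((sum_le_sum fun d _ => hle d).trans (sum_Ioo_inv_sq_le N n))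

/-- A sum of a nonnegative monotone function differs from its integral by at most the last
value. -/
theorem abs_sum_Ioc_sub_integral_le {h : ℝ → ℝ} (hmono : MonotoneOn h (Set.Ici 0))
    (h0 : 0 ≤ h 0) {b : ℝ} (hb : 0 ≤ b) :
    |∑ n ∈ Ioc 0 ⌊b⌋₊, h n - ∫ t in (0 : ℝ)..b, h t| ≤ h b := by
  set N := ⌊b⌋₊ with hN
  have hNb : (N : ℝ) ≤ b := Nat.floor_le hb
  have hbN : b < N + 1 := Nat.lt_floor_add_one b
  have hint {x y : ℝ} (hx : 0 ≤ x) (hxy : x ≤ y) :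
      IntervalIntegrable h MeasureTheory.volume x y :=
    (hmono.mono (by
      rw [Set.uIcc_of_le hxy]; exact fun z hz => hx.trans hz.1)).intervalIntegrable
  have hmono' : MonotoneOn h (Set.Icc ((0 : ℕ) : ℝ) N) :=
    hmono.mono fun z hz => by simpa using hz.1
  have h1 := hmono'.sum_le_integral_Ico (Nat.zero_le N)
  have h2 := hmono'.integral_le_sum_Ico (Nat.zero_le N)
  have hshift : ∑ i ∈ Ico 0 N, h ((i + 1 : ℕ) : ℝ) = ∑ n ∈ Ioc 0 N, h n := by
    rw [Finset.sum_Ico_add' (fun i : ℕ => h i) 0 N 1]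
    rfl
  have htel : ∑ i ∈ Ico 0 N, h ((i + 1 : ℕ) : ℝ) = ∑ i ∈ Ico 0 N, h i + h N - h 0 := by
    have := Finset.sum_range_sub (fun i : ℕ => h i) N
    rw [sum_sub_distrib] at this
    simp only [Nat.cast_zero, ← Finset.range_eq_Ico] at this ⊢
    linarith
  rw [← intervalIntegral.integral_add_adjacent_intervals (hint le_rfl (Nat.cast_nonneg N))
    (hint (Nat.cast_nonneg N) hNb)]
  have hle : h N ≤ h b := hmono (Set.mem_Ici.2 (Nat.cast_nonneg N)) hb hNb
  have h0N : h 0 ≤ h N := hmono Set.self_mem_Ici (Set.mem_Ici.2 (Nat.cast_nonneg N)) (Nat.cast_nonneg N)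
  have hlast : ∫ t in (N : ℝ)..b, h t ≤ h b := by
    calc ∫ t in (N : ℝ)..b, h t ≤ ∫ _ in (N : ℝ)..b, h b :=
          intervalIntegral.integral_mono_on hNb (hint (Nat.cast_nonneg N) hNb) (by simp)
            fun t ht => hmono ((Nat.cast_nonneg N).trans ht.1) hb ht.2
      _ = (b - N) * h b := by simp
      _ ≤ 1 * h b := by gcongr <;> linarith
      _ = h b := one_mul _
  have hlast0 : 0 ≤ ∫ t in (N : ℝ)..b, h t :=
    intervalIntegral.integral_nonneg hNb fun t ht =>
      h0.trans (hmono Set.self_mem_Ici ((Nat.cast_nonneg N).trans ht.1)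
        ((Nat.cast_nonneg N).trans ht.1))
  simp only [Nat.cast_zero] at h1 h2
  rw [abs_le]
  constructor <;> linarith

/-- For `h` nonnegative and monotone on `[0, ∞)`, the sum of `φ(n)/n · h(n)` over `n ≤ b` is
`6/π²` times the integral of `h` over `[0, b]`, up to `h(b) (3 + log b)`. -/
theorem abs_sum_totient_div_mul_sub_integral_le {h : ℝ → ℝ}
    (hmono : MonotoneOn h (Set.Ici 0)) (h0 : 0 ≤ h 0) {b : ℝ} (hb : 0 ≤ b) :
    |∑ n ∈ Ioc 0 ⌊b⌋₊, (Nat.totient n : ℝ) / n * h n - 6 / π ^ 2 * ∫ t in (0 : ℝ)..b, h t| ≤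
      h b * (3 + Real.log ⌊b⌋₊) := by
  set N := ⌊b⌋₊ with hN
  set I := ∫ t in (0 : ℝ)..b, h t with hI
  have hbN : b < N + 1 := Nat.lt_floor_add_one b
  have hb0 : 0 ≤ h b := h0.trans (hmono Set.self_mem_Ici hb hb)
  have hI0 : 0 ≤ I := intervalIntegral.integral_nonneg hb fun t ht =>
    h0.trans (hmono Set.self_mem_Ici ht.1 ht.1)
  have hIb : I ≤ b * h b := by
    calc I ≤ ∫ _ in (0 : ℝ)..b, h b :=
          intervalIntegral.integral_mono_on hb
            (hmono.mono (by
              rw [Set.uIcc_of_le hb]; exact fun z hz => hz.1)).intervalIntegrable (by simp)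
            fun t ht => hmono ht.1 hb ht.2
      _ = b * h b := by simp
  have hconv : ∑ n ∈ Ioc 0 N, (Nat.totient n : ℝ) / n * h n =
      ∑ d ∈ Ioc 0 N, (ArithmeticFunction.moebius d : ℝ) / d *
        ∑ m ∈ Ioc 0 (N / d), h (d * m) := by
    simp_rw [mul_sum]
    rw [← sum_Ioc_sum_divisorsAntidiagonal
      (fun d m => (ArithmeticFunction.moebius d : ℝ) / d * h (d * m))]
    refine sum_congr rfl fun n hn => ?_
    rw [totient_eq_sum_moebius_mul (mem_Ioc.1 hn).1, sum_div, sum_mul]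
    refine sum_congr rfl fun x hx => ?_
    obtain ⟨hxn, hn0⟩ := Nat.mem_divisorsAntidiagonal.1 hx
    rw [← hxn] at hn0 ⊢
    have h1 : (x.1 : ℝ) ≠ 0 := by exact_mod_cast left_ne_zero_of_mul hn0
    have h2 : (x.2 : ℝ) ≠ 0 := by exact_mod_cast right_ne_zero_of_mul hn0
    push_cast
    field_simp
  have hinner : ∀ d ∈ Ioc 0 N,
      |(ArithmeticFunction.moebius d : ℝ) / d * ∑ m ∈ Ioc 0 (N / d), h (d * m) -
        (ArithmeticFunction.moebius d : ℝ) / (d : ℝ) ^ 2 * I| ≤ (d : ℝ)⁻¹ * h b := by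
    intro d hd
    have hd0 : (0 : ℝ) < d := by exact_mod_cast (mem_Ioc.1 hd).1
    have hmono' : MonotoneOn (fun t => h (d * t)) (Set.Ici 0) := fun x hx y hy hxy =>
      hmono (mul_nonneg hd0.le hx) (mul_nonneg hd0.le hy) (by gcongr)
    have key := abs_sum_Ioc_sub_integral_le hmono' (by simpa using h0)
      (b := b / d) (by positivity)
    rw [Nat.floor_div_natCast, intervalIntegral.integral_comp_mul_left _ hd0.ne', mul_zero,
      mul_div_cancel₀ _ hd0.ne', smul_eq_mul] at key
    have hfac : (ArithmeticFunction.moebius d : ℝ) / d * ∑ m ∈ Ioc 0 (N / d), h (d * m) -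
        (ArithmeticFunction.moebius d : ℝ) / (d : ℝ) ^ 2 * I =
        (ArithmeticFunction.moebius d : ℝ) / d *
          (∑ m ∈ Ioc 0 (N / d), h (d * m) - (d : ℝ)⁻¹ * I) := by
      field_simp
    rw [hfac, abs_mul]
    gcongr
    rw [abs_div, abs_of_pos hd0, ← one_div]
    gcongr
    exact_mod_cast ArithmeticFunction.abs_moebius_le_one
  have hharm : ∑ d ∈ Ioc 0 N, (d : ℝ)⁻¹ ≤ 1 + Real.log N := by
    have := harmonic_le_one_add_log N
    rw [harmonic_eq_sum_Icc] at this
    push_cast at this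
    exact this
  have hfirst : |∑ n ∈ Ioc 0 N, (Nat.totient n : ℝ) / n * h n -
      (∑ d ∈ Ioc 0 N, (ArithmeticFunction.moebius d : ℝ) / (d : ℝ) ^ 2) * I| ≤
      (1 + Real.log N) * h b := by
    rw [hconv, sum_mul, ← sum_sub_distrib]
    calc _ ≤ _ := abs_sum_le_sum_abs _ _
      _ ≤ ∑ d ∈ Ioc 0 N, (d : ℝ)⁻¹ * h b := sum_le_sum hinner
      _ = (∑ d ∈ Ioc 0 N, (d : ℝ)⁻¹) * h b := (sum_mul _ _ _).symm
      _ ≤ _ := by gcongr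
  have hsecond : |(∑ d ∈ Ioc 0 N, (ArithmeticFunction.moebius d : ℝ) / (d : ℝ) ^ 2) * I -
      6 / π ^ 2 * I| ≤ 2 * h b := by
    rw [← sub_mul, abs_mul, abs_of_nonneg hI0]
    calc _ ≤ 2 / ((N : ℝ) + 1) * (((N : ℝ) + 1) * h b) := by
          gcongr
          · exact abs_sum_Ioc_moebius_div_sq_sub_le N
          · exact hIb.trans (by gcongr)
      _ = 2 * h b := by field_simp
  calc _ ≤ _ := abs_sub_le _ _ _
    _ ≤ (1 + Real.log N) * h b + 2 * h b := add_le_add hfirst hsecond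
    _ = _ := by ring

/-- A primitive of `u ↦ √(D + 4A/u)`. -/
noncomputable def sqrtPrimitive (A D u : ℝ) : ℝ :=
  √(D * u ^ 2 + 4 * A * u) + 4 * A / √D * Real.log (√(D * u) + √(D * u + 4 * A))

theorem hasDerivAt_sqrtPrimitive {A D u : ℝ} (hD : 0 < D) (hu : 0 < u)
    (hq : 0 < D * u + 4 * A) :
    HasDerivAt (sqrtPrimitive A D) (√(D * u + 4 * A) / √u) u := by
  have hprod : D * u ^ 2 + 4 * A * u = u * (D * u + 4 * A) := by ring
  have hlin : HasDerivAt (fun u : ℝ => D * u) D u := by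
    simpa using (hasDerivAt_id u).const_mul D
  have hquad : HasDerivAt (fun u : ℝ => D * u ^ 2 + 4 * A * u) (D * (2 * u) + 4 * A) u := by
    simpa using ((hasDerivAt_pow 2 u).const_mul D).fun_add ((hasDerivAt_id u).const_mul (4 * A))
  have h1 := hquad.sqrt (by rw [hprod]; positivity)
  have h2 := ((hlin.sqrt (by positivity)).add ((hlin.add_const (4 * A)).sqrt hq.ne')).log
    (by simp only [Pi.add_apply]; positivity)
  refine (h1.add (h2.const_mul (4 * A / √D))).congr_deriv ?_
  simp only [Pi.add_apply]
  rw [hprod, Real.sqrt_mul hu.le, Real.sqrt_mul hD.le]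
  have hq2 := Real.sq_sqrt hq.le
  have hq0 := Real.sqrt_pos.2 hq
  have hr2 := Real.sq_sqrt hu.le
  have hr0 := Real.sqrt_pos.2 hu
  have hw2 := Real.sq_sqrt hD.le
  have hw0 := Real.sqrt_pos.2 hD
  generalize √(D * u + 4 * A) = q at *
  generalize √u = r at *
  generalize √D = w at *
  obtain rfl : A = (q ^ 2 - w ^ 2 * r ^ 2) / 4 := by
    rw [hq2, hw2, hr2]; ring
  subst hr2 hw2
  field_simp
  ring

theorem continuousOn_sqrtPrimitive {A D s : ℝ} (hA : A ≠ 0) (hD : 0 < D) (hs0 : 0 ≤ s)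
    (hs : 0 ≤ D * s + 4 * A) : ContinuousOn (sqrtPrimitive A D) (Set.Ici s) := by
  have hlog : ContinuousOn (fun u => Real.log (√(D * u) + √(D * u + 4 * A))) (Set.Ici s) := by
    refine ContinuousOn.log (by fun_prop) fun u hu => ?_
    have hu' : D * s ≤ D * u := by gcongr; exact hu
    rcases (hs0.trans hu).eq_or_lt with h0 | h0
    · have : 0 < D * u + 4 * A := by
        refine (hs.trans (by linarith)).lt_of_ne' ?_
        rw [← h0]
        simpa using hA
      positivity
    · positivity
  unfold sqrtPrimitive
  exact ContinuousOn.add (by fun_prop) (continuousOn_const.mul hlog)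

theorem integral_sqrt_eq_sqrtPrimitive_sub {A D s₁ s₂ Δ : ℝ} (hA : A ≠ 0) (hD : 0 < D)
    (hs0 : 0 ≤ s₁) (hs : 0 ≤ D * s₁ + 4 * A) (hs₁₂ : s₁ ≤ s₂) (hΔ : 0 < Δ) :
    ∫ t in √(s₁ * Δ)..√(s₂ * Δ), √(D * t ^ 2 + 4 * A * Δ) =
      Δ / 2 * (sqrtPrimitive A D s₂ - sqrtPrimitive A D s₁) := by
  have hsub {s : ℝ} (hs : 0 ≤ s) : √(s * Δ) ^ 2 / Δ = s := by
    rw [Real.sq_sqrt (by positivity)]; field_simp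
  have hab : √(s₁ * Δ) ≤ √(s₂ * Δ) := by gcongr
  rw [intervalIntegral.integral_eq_sub_of_hasDerivAt_of_le
    (f := fun t => Δ / 2 * sqrtPrimitive A D (t ^ 2 / Δ)) hab]
  · simp only [hsub hs0, hsub (hs0.trans hs₁₂)]
    ring
  · refine continuousOn_const.mul
      ((continuousOn_sqrtPrimitive hA hD hs0 hs).comp (by fun_prop) fun t ht => ?_)
    rw [Set.mem_Ici, ← hsub hs0]
    gcongr
    exact ht.1
  · intro t ht
    have ht0 : 0 < t := (Real.sqrt_nonneg _).trans_lt ht.1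
    have hu : s₁ < t ^ 2 / Δ := by
      rw [← hsub hs0]
      gcongr
      exact ht.1
    have hq : 0 < D * (t ^ 2 / Δ) + 4 * A := by
      have : D * s₁ < D * (t ^ 2 / Δ) := by gcongr
      linarith
    have hinner : HasDerivAt (fun t : ℝ => t ^ 2 / Δ) (2 * t / Δ) t := by
      simpa using (hasDerivAt_pow 2 t).div_const Δ
    refine (((hasDerivAt_sqrtPrimitive hD (hs0.trans_lt hu) hq).comp t hinner).const_mul
      (Δ / 2)).congr_deriv ?_
    have hfac : D * t ^ 2 + 4 * A * Δ = Δ * (D * (t ^ 2 / Δ) + 4 * A) := by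
      field_simp
    rw [hfac, Real.sqrt_mul hΔ.le, Real.sqrt_div (sq_nonneg t), Real.sqrt_sq ht0.le]
    have := Real.sqrt_pos.2 hΔ
    field_simp
  · exact (by fun_prop : Continuous fun t => √(D * t ^ 2 + 4 * A * Δ)).intervalIntegrable _ _

/-- Abel-summation asymptotic: for `A ≠ 0`, `D > 0`, `s₂ ≥ s₁ ≥ max(0, -4A/D)`, as
`Δ → ∞`,
`∑_{√(s₁Δ) < n ≤ √(s₂Δ)} φ(n)·√(D + 4AΔ/n²)
  = (3Δ/π²)·[√(Du² + 4Au) + (4A/√D)·log(√(Du) + √(Du + 4A))]_{u=s₁}^{u=s₂}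
    + O(√Δ·(log Δ)²)`. -/
theorem sum_totient_sqrt_asymptotic (A D s₁ s₂ : ℝ) (hA : A ≠ 0) (hD : 0 < D)
    (hs₁ : max 0 (-4 * A / D) ≤ s₁) (hs₁₂ : s₁ ≤ s₂) :
    ∃ C : ℝ, 0 < C ∧ ∃ Δ₀ : ℝ, ∀ Δ : ℝ, Δ₀ ≤ Δ →
      |(∑ n ∈ Finset.Ioc ⌊Real.sqrt (s₁ * Δ)⌋₊ ⌊Real.sqrt (s₂ * Δ)⌋₊,
            (Nat.totient n : ℝ) * Real.sqrt (D + 4 * A * Δ / (n : ℝ) ^ 2)) -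
          3 * Δ / π ^ 2 *
            ((Real.sqrt (D * s₂ ^ 2 + 4 * A * s₂) +
                4 * A / Real.sqrt D *
                  Real.log (Real.sqrt (D * s₂) + Real.sqrt (D * s₂ + 4 * A))) -
              (Real.sqrt (D * s₁ ^ 2 + 4 * A * s₁) +
                4 * A / Real.sqrt D *
                  Real.log (Real.sqrt (D * s₁) + Real.sqrt (D * s₁ + 4 * A))))| ≤
        C * Real.sqrt Δ * (Real.log Δ) ^ 2 := by
  have hs0 : 0 ≤ s₁ := (le_max_left _ _).trans hs₁
  have hs2 : 0 ≤ s₂ := hs0.trans hs₁₂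
  have hs : 0 ≤ D * s₁ + 4 * A := by
    have := (div_le_iff₀ hD).1 ((le_max_right _ _).trans hs₁)
    linarith
  have hlog0 : 0 ≤ Real.log (s₂ + 1) := Real.log_nonneg (by linarith)
  refine ⟨2 * √(D * s₂ + 4 * A) * (4 + Real.log (s₂ + 1)) + 1, by positivity, Real.exp 1,
    fun Δ hΔe => ?_⟩
  have hΔ1 : 1 ≤ Δ := (Real.one_le_exp zero_le_one).trans hΔe
  have hΔ : 0 < Δ := zero_lt_one.trans_le hΔ1
  have hlog1 : 1 ≤ Real.log Δ := by rwa [Real.le_log_iff_exp_le hΔ]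
  change |_ - 3 * Δ / π ^ 2 * (sqrtPrimitive A D s₂ - sqrtPrimitive A D s₁)| ≤ _
  set h : ℝ → ℝ := fun t => √(D * t ^ 2 + 4 * A * Δ) with hh
  set a := √(s₁ * Δ) with ha
  set b := √(s₂ * Δ) with hb
  have ha0 : 0 ≤ a := Real.sqrt_nonneg _
  have hb0 : 0 ≤ b := Real.sqrt_nonneg _
  have hab : a ≤ b := Real.sqrt_le_sqrt (by gcongr)
  have hcont : Continuous h := by fun_prop
  have hmono : MonotoneOn h (Set.Ici 0) := fun x hx y _ hxy =>
    Real.sqrt_le_sqrt (by have : (0 : ℝ) ≤ x := hx; gcongr)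
  have hterm : ∀ n : ℕ, (Nat.totient n : ℝ) * √(D + 4 * A * Δ / (n : ℝ) ^ 2) =
      (Nat.totient n : ℝ) / n * h n := by
    intro n
    rcases n.eq_zero_or_pos with rfl | hn
    · simp
    have hn' : (0 : ℝ) < n := by exact_mod_cast hn
    have hfac : D * (n : ℝ) ^ 2 + 4 * A * Δ = (n : ℝ) ^ 2 * (D + 4 * A * Δ / (n : ℝ) ^ 2) := by
      field_simp
    simp only [hh]
    rw [hfac, Real.sqrt_mul (sq_nonneg _), Real.sqrt_sq hn'.le]
    field_simp
  have hsplit : ∑ n ∈ Ioc ⌊a⌋₊ ⌊b⌋₊, (Nat.totient n : ℝ) / n * h n =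
      ∑ n ∈ Ioc 0 ⌊b⌋₊, (Nat.totient n : ℝ) / n * h n -
        ∑ n ∈ Ioc 0 ⌊a⌋₊, (Nat.totient n : ℝ) / n * h n := by
    rw [← sum_Ioc_consecutive _ (Nat.zero_le _) (Nat.floor_mono hab)]
    ring
  have hint := integral_sqrt_eq_sqrtPrimitive_sub hA hD hs0 hs hs₁₂ hΔ
  rw [← intervalIntegral.integral_interval_sub_left (hcont.intervalIntegrable 0 b)
    (hcont.intervalIntegrable 0 a)] at hint
  have h0 : 0 ≤ h 0 := Real.sqrt_nonneg _
  have eb := abs_sum_totient_div_mul_sub_integral_le hmono h0 hb0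
  have ea := abs_sum_totient_div_mul_sub_integral_le hmono h0 ha0
  have hlogfloor : Real.log ⌊b⌋₊ ≤ Real.log (s₂ + 1) + Real.log Δ := by
    rcases Nat.eq_zero_or_pos ⌊b⌋₊ with hN | hN
    · rw [hN, Nat.cast_zero, Real.log_zero]
      positivity
    rw [← Real.log_mul (by positivity) hΔ.ne']
    refine Real.log_le_log (by exact_mod_cast hN) ((Nat.floor_le hb0).trans ?_)
    rw [hb, Real.sqrt_le_left (by positivity)]
    nlinarith [mul_nonneg hs2 hΔ.le]
  have hhb : h b = √Δ * √(D * s₂ + 4 * A) := by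
    simp only [hh, hb]
    rw [Real.sq_sqrt (by positivity), ← Real.sqrt_mul hΔ.le]
    ring_nf
  have hha : h a * (3 + Real.log ⌊a⌋₊) ≤ h b * (3 + Real.log ⌊b⌋₊) := by
    have hlogab : Real.log ⌊a⌋₊ ≤ Real.log ⌊b⌋₊ := by
      rcases Nat.eq_zero_or_pos ⌊a⌋₊ with hN | hN
      · rw [hN, Nat.cast_zero, Real.log_zero]
        exact Real.log_natCast_nonneg _
      · exact Real.log_le_log (by exact_mod_cast hN) (by exact_mod_cast Nat.floor_mono hab)
    have := Real.log_natCast_nonneg ⌊a⌋₊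
    exact mul_le_mul (hmono ha0 hb0 hab) (by linarith) (by linarith) (Real.sqrt_nonneg _)
  have hbound : h b * (3 + Real.log ⌊b⌋₊) ≤
      √Δ * √(D * s₂ + 4 * A) * ((4 + Real.log (s₂ + 1)) * Real.log Δ ^ 2) := by
    rw [hhb]
    gcongr
    nlinarith [mul_nonneg hlog0 (sub_nonneg.2 hlog1)]
  have hmain : 3 * Δ / π ^ 2 * (sqrtPrimitive A D s₂ - sqrtPrimitive A D s₁) =
      6 / π ^ 2 * (∫ t in (0 : ℝ)..b, h t) - 6 / π ^ 2 * ∫ t in (0 : ℝ)..a, h t := by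
    rw [← mul_sub, hint]
    ring
  rw [sum_congr rfl fun n _ => hterm n, hsplit, hmain, sub_sub_sub_comm]
  refine (abs_sub _ _).trans ((add_le_add eb (ea.trans hha)).trans ?_)
  have : 0 ≤ √Δ * Real.log Δ ^ 2 := by positivity
  linarith
end

section
/- Fix real numbers A > 0, B, C with D := B^2 − 4AC < 0, and fix any closed interval [X,Y] ⊆ ℝ. Then for every ε > 0, as Δ → ∞, the number of pairs (m,n) with n ≥ 1, gcd(m,n)=1, X ≤ m/n ≤ Y, and A·m^2 + B·m·n + C·n^2 ≤ Δ equals (3Δ/π^2)·(2/sqrt(−D))·[ arctan( (2At + B)/sqrt(−D) ) ] evaluated from t = X to t = Y, plus an error O(Δ^{1/2+ε}). -/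
open Real

open MeasureTheory Set in
/-- A bounded interval contains as many integers as its length, up to an error of one. -/
lemma abs_ncard_int_sub_volume_le_one {s : Set ℝ} (hs : s.OrdConnected) {a b : ℝ}
    (hsub : s ⊆ Icc a b) :
    |({n : ℤ | (n : ℝ) ∈ s}.ncard : ℝ) - volume.real s| ≤ 1 := by
  rcases s.eq_empty_or_nonempty with rfl | hne
  · simp
  have hbb : BddBelow s := ⟨a, fun x hx => (hsub hx).1⟩
  have hba : BddAbove s := ⟨b, fun x hx => (hsub hx).2⟩
  set u := sInf s
  set v := sSup s
  have huv : u ≤ v := csInf_le_csSup hne hbb hba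
  have hin : s ⊆ Icc u v := fun x hx => ⟨csInf_le hbb hx, le_csSup hba hx⟩
  have hout : Ioo u v ⊆ s := by
    rintro x ⟨h1, h2⟩
    obtain ⟨y, hy, hyx⟩ := exists_lt_of_csInf_lt hne h1
    obtain ⟨z, hz, hxz⟩ := exists_lt_of_lt_csSup hne h2
    exact hs.out hy hz ⟨hyx.le, hxz.le⟩
  have hvol : volume.real s = v - u := by
    apply le_antisymm
    · calc volume.real s ≤ volume.real (Icc u v) := measureReal_mono hin (by simp)
        _ = v - u := by simp [huv]
    · calc v - u = volume.real (Ioo u v) := by simp [huv]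
        _ ≤ volume.real s :=
          measureReal_mono hout (ne_top_of_le_ne_top (by simp) (measure_mono hin))
  have hsupper : {n : ℤ | (n : ℝ) ∈ s} ⊆ Icc ⌈u⌉ ⌊v⌋ := by
    rw [← Int.preimage_Icc]
    exact preimage_mono hin
  have hlower : Ioo ⌊u⌋ ⌈v⌉ ⊆ {n : ℤ | (n : ℝ) ∈ s} := by
    rw [← Int.preimage_Ioo]
    exact preimage_mono hout
  have hle := ncard_le_ncard hsupper (finite_Icc _ _)
  have hge := ncard_le_ncard hlower ((finite_Icc _ _).subset hsupper)
  rw [ncard_eq_toFinset_card' (Icc _ _), toFinset_Icc, Int.card_Icc] at hle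
  rw [ncard_eq_toFinset_card' (Ioo _ _), toFinset_Ioo, Int.card_Ioo] at hge
  set N := {n : ℤ | (n : ℝ) ∈ s}.ncard
  have h1 : ((⌈v⌉ - ⌊u⌋ - 1 : ℤ) : ℝ) ≤ N := by
    have : ⌈v⌉ - ⌊u⌋ - 1 ≤ (N : ℤ) := by omega
    exact_mod_cast this
  have h2 : (N : ℝ) ≤ max (((⌊v⌋ + 1 - ⌈u⌉ : ℤ)) : ℝ) 0 := by
    have : (N : ℤ) ≤ max (⌊v⌋ + 1 - ⌈u⌉) 0 := by omega
    exact_mod_cast this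
  have h3 : max (((⌊v⌋ + 1 - ⌈u⌉ : ℤ)) : ℝ) 0 ≤ v - u + 1 := by
    apply max_le _ (by linarith)
    push_cast
    linarith [Int.floor_le v, Int.le_ceil u]
  push_cast at h1
  rw [hvol, abs_le]
  constructor <;> linarith [Int.le_ceil v, Int.floor_le u]

open MeasureTheory Set in
/-- The number of lattice points of a planar set whose horizontal and vertical slices are
intervals is its area, up to an error linear in the size of a box containing it. -/
lemma abs_ncard_lattice_sub_volume_le {S : Set (ℝ × ℝ)} (hS : MeasurableSet S) {R : ℝ}
    (hR : 0 ≤ R) (hsub : S ⊆ Icc (-R) R ×ˢ Icc (-R) R)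
    (hx : ∀ x, {y | (x, y) ∈ S}.OrdConnected) (hy : ∀ y, {x | (x, y) ∈ S}.OrdConnected) :
    |({p : ℤ × ℤ | ((p.1 : ℝ), (p.2 : ℝ)) ∈ S}.ncard : ℝ) - volume.real S| ≤ 4 * R + 1 := by
  classical
  set I : Finset ℤ := Finset.Icc (-⌊R⌋) ⌊R⌋ with hI
  have memI : ∀ n : ℤ, (n : ℝ) ∈ Icc (-R) R → n ∈ I := by
    rintro n ⟨h1, h2⟩
    rw [hI, Finset.mem_Icc]
    refine ⟨?_, Int.le_floor.2 h2⟩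
    have : -n ≤ ⌊R⌋ := Int.le_floor.2 (by push_cast; linarith)
    omega
  have hcardI : (I.card : ℝ) ≤ 2 * R + 1 := by
    have h0 : 0 ≤ ⌊R⌋ := Int.floor_nonneg.2 hR
    have : (I.card : ℤ) = 2 * ⌊R⌋ + 1 := by
      rw [hI, Int.card_Icc]; omega
    have h2 : (I.card : ℝ) = 2 * ⌊R⌋ + 1 := by exact_mod_cast this
    linarith [Int.floor_le R]
  have hslice : ∀ x, {y | (x, y) ∈ S} ⊆ Icc (-R) R := fun x y h => (hsub h).2
  have hslice' : ∀ y, {x | (x, y) ∈ S} ⊆ Icc (-R) R := fun y x h => (hsub h).1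
  have hmeas : ∀ y : ℝ, MeasurableSet {x | (x, y) ∈ S} := fun y => measurable_prodMk_right hS
  have hcount : ({p : ℤ × ℤ | ((p.1 : ℝ), (p.2 : ℝ)) ∈ S}.ncard : ℝ)
      = ∑ n ∈ I, ({m : ℤ | ((m : ℝ), (n : ℝ)) ∈ S}.ncard : ℝ) := by
    have e1 : {p : ℤ × ℤ | ((p.1 : ℝ), (p.2 : ℝ)) ∈ S}
        = ((I ×ˢ I).filter fun p : ℤ × ℤ => ((p.1 : ℝ), (p.2 : ℝ)) ∈ S : Finset (ℤ × ℤ)) := by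
      ext p
      simp only [mem_ofPred_eq, Finset.coe_filter, Finset.mem_product]
      exact ⟨fun h => ⟨⟨memI _ (hsub h).1, memI _ (hsub h).2⟩, h⟩, fun h => h.2⟩
    have e2 : ∀ n : ℤ, {m : ℤ | ((m : ℝ), (n : ℝ)) ∈ S}
        = (I.filter fun m : ℤ => ((m : ℝ), (n : ℝ)) ∈ S : Finset ℤ) := by
      intro n
      ext m
      simp only [mem_ofPred_eq, Finset.coe_filter]
      exact ⟨fun h => ⟨memI _ (hsub h).1, h⟩, fun h => h.2⟩
    simp_rw [e1, e2, ncard_coe_finset, Finset.card_filter]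
    rw [Finset.sum_product_right]
    push_cast
    rfl
  have herr1 : |∑ n ∈ I, ({m : ℤ | ((m : ℝ), (n : ℝ)) ∈ S}.ncard : ℝ)
      - ∑ n ∈ I, volume.real {x : ℝ | (x, (n : ℝ)) ∈ S}| ≤ 2 * R + 1 := by
    rw [← Finset.sum_sub_distrib]
    refine (Finset.abs_sum_le_sum_abs _ _).trans (le_trans ?_ hcardI)
    rw [Finset.card_eq_sum_ones]
    push_cast
    exact Finset.sum_le_sum fun n _ =>
      abs_ncard_int_sub_volume_le_one (s := {x : ℝ | (x, (n : ℝ)) ∈ S}) (hy n) (hslice' n)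
  have hcol : ∀ x : ℝ, ({n : ℤ | (x, (n : ℝ)) ∈ S}.ncard : ℝ)
      = ∑ n ∈ I, {z : ℝ | (z, (n : ℝ)) ∈ S}.indicator (1 : ℝ → ℝ) x := by
    intro x
    have e2 : {n : ℤ | (x, (n : ℝ)) ∈ S}
        = (I.filter fun n : ℤ => (x, (n : ℝ)) ∈ S : Finset ℤ) := by
      ext m
      simp only [mem_ofPred_eq, Finset.coe_filter]
      exact ⟨fun h => ⟨memI _ (hsub h).2, h⟩, fun h => h.2⟩
    rw [e2, ncard_coe_finset, Finset.card_filter]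
    push_cast
    refine Finset.sum_congr rfl fun n _ => ?_
    simp [indicator_apply]
  have hint : ∀ n : ℤ, IntegrableOn
      ({z : ℝ | (z, (n : ℝ)) ∈ S}.indicator (1 : ℝ → ℝ)) (Icc (-R) R) := fun n =>
    (integrable_indicator_iff (hmeas n)).2 (integrableOn_const (by
      rw [Measure.restrict_apply (hmeas n)]
      exact ne_top_of_le_ne_top (by simp) (measure_mono inter_subset_right)))
  have hswap : ∑ n ∈ I, volume.real {x : ℝ | (x, (n : ℝ)) ∈ S}
      = ∫ x in Icc (-R) R, ({n : ℤ | (x, (n : ℝ)) ∈ S}.ncard : ℝ) := by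
    simp_rw [hcol]
    rw [integral_finsetSum _ fun n _ => hint n]
    refine Finset.sum_congr rfl fun n _ => ?_
    rw [integral_indicator_one (hmeas n), measureReal_restrict_apply (hmeas n),
      inter_eq_left.2 (hslice' n)]
  have hfin : volume S ≠ ⊤ := by
    refine ne_top_of_le_ne_top ?_ (measure_mono hsub)
    rw [Measure.volume_eq_prod, Measure.prod_prod]
    exact ENNReal.mul_ne_top (by simp) (by simp)
  have hlenint : Integrable fun x => volume.real {y | (x, y) ∈ S} :=
    Measure.integrable_measure_prodMk_left hS (by rwa [← Measure.volume_eq_prod])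
  have harea : volume.real S = ∫ x in Icc (-R) R, volume.real {y | (x, y) ∈ S} := by
    rw [setIntegral_eq_integral_of_forall_compl_eq_zero]
    · rw [measureReal_def, Measure.volume_eq_prod, Measure.prod_apply hS]
      exact (integral_toReal (measurable_measure_prodMk_left hS).aemeasurable
        (Filter.Eventually.of_forall fun x => by
          exact (measure_mono (hslice x)).trans_lt (by simp))).symm
    · intro x hxR
      have : {y | (x, y) ∈ S} = ∅ := eq_empty_of_forall_notMem fun y h => hxR (hsub h).1
      simp [this]
  have herr2 : |(∫ x in Icc (-R) R, ({n : ℤ | (x, (n : ℝ)) ∈ S}.ncard : ℝ))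
      - ∫ x in Icc (-R) R, volume.real {y | (x, y) ∈ S}| ≤ 2 * R := by
    rw [← integral_sub _ hlenint.integrableOn]
    · have := norm_setIntegral_le_of_norm_le_const (μ := volume) (s := Icc (-R) R) (C := 1)
        (f := fun x => ({n : ℤ | (x, (n : ℝ)) ∈ S}.ncard : ℝ) - volume.real {y | (x, y) ∈ S})
        (by simp) fun x _ =>
          abs_ncard_int_sub_volume_le_one (s := {y : ℝ | (x, y) ∈ S}) (hx x) (hslice x)
      rw [Real.norm_eq_abs, Real.volume_real_Icc_of_le (by linarith)] at this
      linarith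
    · simp_rw [hcol]
      exact integrable_finsetSum _ fun n _ => hint n
  rw [hcount, harea]
  rw [hswap] at herr1
  rw [abs_le] at *
  constructor <;> linarith [herr1.1, herr1.2, herr2.1, herr2.2]

open ArithmeticFunction in
/-- Möbius inversion for the coprime members of a finite set of pairs of integers. -/
lemma card_filter_gcd_eq_one (P : Finset (ℤ × ℤ)) (K : ℕ)
    (hP : ∀ p ∈ P, Int.gcd p.1 p.2 ∈ Finset.Icc 1 K) :
    ((P.filter fun p => Int.gcd p.1 p.2 = 1).card : ℝ)
      = ∑ d ∈ Finset.Icc 1 K, (moebius d : ℝ)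
          * (P.filter fun p => d ∣ Int.gcd p.1 p.2).card := by
  have hone : ∀ n : ℕ, ∑ d ∈ n.divisors, (moebius d : ℝ) = if n = 1 then 1 else 0 := by
    intro n
    have h := congrArg (fun f : ArithmeticFunction ℤ => f n) coe_zeta_mul_moebius
    simp only [coe_zeta_mul_apply, one_apply] at h
    exact_mod_cast h
  calc ((P.filter fun p => Int.gcd p.1 p.2 = 1).card : ℝ)
      = ∑ p ∈ P, ∑ d ∈ Finset.Icc 1 K,
          if d ∣ Int.gcd p.1 p.2 then (moebius d : ℝ) else 0 := by
        rw [Finset.card_filter]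
        push_cast
        refine Finset.sum_congr rfl fun p hp => ?_
        have hg := Finset.mem_Icc.1 (hP p hp)
        rw [← hone, ← Finset.sum_filter]
        refine Finset.sum_congr ?_ fun _ _ => rfl
        ext d
        simp only [Nat.mem_divisors, Finset.mem_filter, Finset.mem_Icc]
        constructor
        · rintro ⟨h, h0⟩
          exact ⟨⟨Nat.pos_of_dvd_of_pos h hg.1, (Nat.le_of_dvd hg.1 h).trans hg.2⟩, h⟩
        · rintro ⟨-, h⟩
          exact ⟨h, by omega⟩
    _ = _ := by
        rw [Finset.sum_comm]
        refine Finset.sum_congr rfl fun d _ => ?_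
        rw [Finset.card_filter]
        push_cast
        rw [Finset.mul_sum]
        simp

open ArithmeticFunction in
/-- Partial sums of the series `∑ μ(d) / d² = 6 / π²`. -/
lemma abs_sum_moebius_div_sq_sub_le (K : ℕ) :
    |∑ d ∈ Finset.Icc 1 K, (moebius d : ℝ) / d ^ 2 - 6 / π ^ 2| ≤ 2 / ((K : ℝ) + 1) := by
  have hsumm : Summable fun d : ℕ => (moebius d : ℝ) / d ^ 2 := by
    refine Summable.of_norm_bounded (g := fun d : ℕ => 1 / (d : ℝ) ^ 2)
      (Real.summable_one_div_nat_pow.2 one_lt_two) fun d => ?_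
    rw [norm_div, Real.norm_eq_abs, norm_pow, RCLike.norm_natCast]
    gcongr
    exact_mod_cast abs_moebius_le_one
  have htsum : ∑' d : ℕ, (moebius d : ℝ) / d ^ 2 = 6 / π ^ 2 := by
    have h := LSeries_zeta_mul_Lseries_moebius (s := 2) (by simp)
    rw [LSeries_zeta_eq_riemannZeta (by simp), riemannZeta_two] at h
    have hterm : LSeries (fun n => ((moebius n : ℤ) : ℂ)) 2
        = ((∑' d : ℕ, (moebius d : ℝ) / d ^ 2 : ℝ) : ℂ) := by
      rw [LSeries, Complex.ofReal_tsum]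
      refine tsum_congr fun n => ?_
      rcases eq_or_ne n 0 with rfl | hn
      · simp
      · rw [LSeries.term_of_ne_zero hn]
        push_cast
        norm_num [Complex.cpow_ofNat]
    rw [hterm] at h
    have h' : π ^ 2 / 6 * ∑' d : ℕ, (moebius d : ℝ) / d ^ 2 = 1 := by exact_mod_cast h
    have := pi_ne_zero
    field_simp at h' ⊢
    linarith
  have hlim := hsumm.hasSum.tendsto_sum_nat
  rw [htsum] at hlim
  have hlim' := (tendsto_const_nhds
    (x := ∑ d ∈ Finset.Icc 1 K, (moebius d : ℝ) / d ^ 2)).sub hlim |>.abs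
  refine le_of_tendsto hlim' ?_
  filter_upwards [Filter.eventually_gt_atTop K] with N hN
  have hsplit : ∑ d ∈ Finset.range N, (moebius d : ℝ) / d ^ 2
      = ∑ d ∈ Finset.Icc 1 K, (moebius d : ℝ) / d ^ 2
        + ∑ d ∈ Finset.Ioo K N, (moebius d : ℝ) / d ^ 2 := by
    rw [← Finset.sum_union]
    · symm
      refine Finset.sum_subset ?_ fun d hd hd' => ?_
      · intro d
        simp only [Finset.mem_union, Finset.mem_Icc, Finset.mem_Ioo, Finset.mem_range]
        omega
      · simp only [Finset.mem_union, Finset.mem_Icc, Finset.mem_Ioo, Finset.mem_range] at hd hd'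
        have : d = 0 := by omega
        simp [this]
    · rw [Finset.disjoint_left]
      intro d
      simp only [Finset.mem_Icc, Finset.mem_Ioo]
      omega
  rw [hsplit, sub_add_cancel_left, abs_neg]
  refine (Finset.abs_sum_le_sum_abs _ _).trans (le_trans ?_ (sum_Ioo_inv_sq_le K N))
  refine Finset.sum_le_sum fun d _ => ?_
  rw [abs_div, abs_of_nonneg (by positivity : (0 : ℝ) ≤ (d : ℝ) ^ 2), div_eq_mul_inv]
  refine mul_le_of_le_one_left (by positivity) ?_
  exact_mod_cast abs_moebius_le_one

/-- The part of the region `A x² + B x y + C y² ≤ Δ` in the open upper half plane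
between the lines `x = X y` and `x = Y y`. -/
def ellipticSector (A B C X Y Δ : ℝ) : Set (ℝ × ℝ) :=
  {p | 0 < p.2 ∧ X * p.2 ≤ p.1 ∧ p.1 ≤ Y * p.2 ∧
    A * p.1 ^ 2 + B * p.1 * p.2 + C * p.2 ^ 2 ≤ Δ}

lemma measurableSet_ellipticSector (A B C X Y Δ : ℝ) :
    MeasurableSet (ellipticSector A B C X Y Δ) := by
  have h0 : MeasurableSet {p : ℝ × ℝ | 0 < p.2} := measurableSet_lt (by fun_prop) (by fun_prop)
  have h1 : MeasurableSet {p : ℝ × ℝ | X * p.2 ≤ p.1} :=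
    measurableSet_le (by fun_prop) (by fun_prop)
  have h2 : MeasurableSet {p : ℝ × ℝ | p.1 ≤ Y * p.2} :=
    measurableSet_le (by fun_prop) (by fun_prop)
  have h3 : MeasurableSet {p : ℝ × ℝ | A * p.1 ^ 2 + B * p.1 * p.2 + C * p.2 ^ 2 ≤ Δ} :=
    measurableSet_le (by fun_prop) (by fun_prop)
  exact h0.inter (h1.inter (h2.inter h3))

lemma quadratic_le_of_mem_Icc {a b c Δ x y z : ℝ} (ha : 0 ≤ a)
    (hx : a * x ^ 2 + b * x + c ≤ Δ) (hy : a * y ^ 2 + b * y + c ≤ Δ)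
    (hz : z ∈ Set.Icc x y) : a * z ^ 2 + b * z + c ≤ Δ := by
  obtain ⟨h1, h2⟩ := hz
  rcases (h1.trans h2).eq_or_lt with rfl | hlt
  · obtain rfl : z = x := le_antisymm h2 h1
    exact hx
  · have hd : 0 < y - x := sub_pos.2 hlt
    have e1 := mul_nonneg (sub_nonneg.2 h2) (sub_nonneg.2 hx)
    have e2 := mul_nonneg (sub_nonneg.2 h1) (sub_nonneg.2 hy)
    have e3 := mul_nonneg (mul_nonneg ha hd.le) (mul_nonneg (sub_nonneg.2 h1) (sub_nonneg.2 h2))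
    have : 0 ≤ (y - x) * (Δ - (a * z ^ 2 + b * z + c)) := by linarith
    linarith [nonneg_of_mul_nonneg_right this hd]

lemma ordConnected_ellipticSector_row {A : ℝ} (hA : 0 ≤ A) (B C X Y Δ y : ℝ) :
    {x | (x, y) ∈ ellipticSector A B C X Y Δ}.OrdConnected := by
  refine ⟨?_⟩
  rintro u ⟨hu0, hu1, hu2, hu3⟩ v ⟨hv0, hv1, hv2, hv3⟩ z hz
  refine ⟨hu0, hu1.trans hz.1, hz.2.trans hv2, ?_⟩
  have := quadratic_le_of_mem_Icc (b := B * y) (c := C * y ^ 2) (Δ := Δ) hA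
    (by dsimp at hu3; linarith) (by dsimp at hv3; linarith) hz
  dsimp
  linarith

lemma ordConnected_ellipticSector_column {C : ℝ} (hC : 0 ≤ C) (A B X Y Δ x : ℝ) :
    {y | (x, y) ∈ ellipticSector A B C X Y Δ}.OrdConnected := by
  refine ⟨?_⟩
  rintro u ⟨hu0, hu1, hu2, hu3⟩ v ⟨hv0, hv1, hv2, hv3⟩ z hz
  dsimp at *
  refine ⟨hu0.trans_le hz.1, ?_, ?_, ?_⟩
  · simpa using quadratic_le_of_mem_Icc (a := 0) (b := X) (c := 0) le_rfl
      (by simpa using hu1) (by simpa using hv1) hz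
  · have := quadratic_le_of_mem_Icc (a := 0) (b := -Y) (c := 0) (Δ := -x) le_rfl
      (by linarith) (by linarith) hz
    dsimp
    linarith
  · have := quadratic_le_of_mem_Icc (b := B * x) (c := A * x ^ 2) (Δ := Δ) hC
      (by linarith) (by linarith) hz
    dsimp
    linarith

lemma ellipticSector_subset {A B C : ℝ} (hA : 0 < A) (hD : B ^ 2 - 4 * A * C < 0)
    (X Y Δ : ℝ) :
    ellipticSector A B C X Y Δ ⊆
      Set.Icc (-√(4 * (A + C) / (4 * A * C - B ^ 2) * Δ)) √(4 * (A + C) / (4 * A * C - B ^ 2) * Δ)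
      ×ˢ Set.Icc (-√(4 * (A + C) / (4 * A * C - B ^ 2) * Δ))
        √(4 * (A + C) / (4 * A * C - B ^ 2) * Δ) := by
  rintro ⟨x, y⟩ ⟨-, -, -, h⟩
  dsimp at h
  have hC : 0 < C := by
    by_contra! hC
    nlinarith [sq_nonneg B, mul_nonneg hA.le (neg_nonneg.2 hC)]
  have hD' : 0 < 4 * A * C - B ^ 2 := by linarith
  have hx : (4 * A * C - B ^ 2) * x ^ 2 ≤ 4 * C * Δ := by
    nlinarith [sq_nonneg (2 * C * y + B * x), mul_le_mul_of_nonneg_left h hC.le]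
  have hy : (4 * A * C - B ^ 2) * y ^ 2 ≤ 4 * A * Δ := by
    nlinarith [sq_nonneg (2 * A * x + B * y), mul_le_mul_of_nonneg_left h hA.le]
  have hΔ : 0 ≤ Δ := by
    have : 0 ≤ 4 * C * Δ := le_trans (by positivity) hx
    exact nonneg_of_mul_nonneg_right this (by positivity)
  have hx' : x ^ 2 ≤ 4 * (A + C) / (4 * A * C - B ^ 2) * Δ := by
    rw [div_mul_eq_mul_div, le_div_iff₀ hD']
    nlinarith [mul_nonneg hA.le hΔ]
  have hy' : y ^ 2 ≤ 4 * (A + C) / (4 * A * C - B ^ 2) * Δ := by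
    rw [div_mul_eq_mul_div, le_div_iff₀ hD']
    nlinarith [mul_nonneg hC.le hΔ]
  exact ⟨abs_le.1 (Real.abs_le_sqrt hx'), abs_le.1 (Real.abs_le_sqrt hy')⟩

lemma quadratic_pos {A B C : ℝ} (hA : 0 < A) (hD : B ^ 2 - 4 * A * C < 0) (t : ℝ) :
    0 < A * t ^ 2 + B * t + C := by
  nlinarith [sq_nonneg (2 * A * t + B)]

lemma integral_one_div_quadratic {A B C : ℝ} (hA : 0 < A) (hD : B ^ 2 - 4 * A * C < 0)
    (X Y : ℝ) :
    ∫ t in X..Y, 1 / (A * t ^ 2 + B * t + C)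
      = 2 / √(-(B ^ 2 - 4 * A * C)) *
        (arctan ((2 * A * Y + B) / √(-(B ^ 2 - 4 * A * C))) -
          arctan ((2 * A * X + B) / √(-(B ^ 2 - 4 * A * C)))) := by
  set s := √(-(B ^ 2 - 4 * A * C)) with hs
  have hs0 : 0 < s := Real.sqrt_pos.2 (by linarith)
  have hs2 : s ^ 2 = 4 * A * C - B ^ 2 := by
    rw [hs, Real.sq_sqrt (by linarith)]; ring
  have hderiv : ∀ t, HasDerivAt (fun t => 2 / s * arctan ((2 * A * t + B) / s))
      (1 / (A * t ^ 2 + B * t + C)) t := by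
    intro t
    have h1 : HasDerivAt (fun t : ℝ => (2 * A * t + B) / s) (2 * A * 1 / s) t :=
      (((hasDerivAt_id t).const_mul (2 * A)).add_const B).div_const s
    refine (h1.arctan.const_mul (2 / s)).congr_deriv ?_
    have hq := quadratic_pos hA hD t
    have h2 : s ^ 2 + (2 * A * t + B) ^ 2 = 4 * A * (A * t ^ 2 + B * t + C) := by
      rw [hs2]; ring
    have h3 : 1 + ((2 * A * t + B) / s) ^ 2 = 4 * A * (A * t ^ 2 + B * t + C) / s ^ 2 := by
      rw [← h2]; field_simp
    rw [h3]
    field_simp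
    norm_num
  rw [intervalIntegral.integral_eq_sub_of_hasDerivAt (fun t _ => hderiv t)]
  · ring
  · refine Continuous.intervalIntegrable ?_ _ _
    exact continuous_const.div (by fun_prop) fun t => (quadratic_pos hA hD t).ne'

open MeasureTheory Set in
lemma lintegral_ofReal_Ioc_zero {b : ℝ} (hb : 0 ≤ b) :
    ∫⁻ y in Ioc 0 b, ENNReal.ofReal y = ENNReal.ofReal (b ^ 2 / 2) := by
  rw [← ofReal_integral_eq_lintegral_ofReal]
  · rw [← intervalIntegral.integral_of_le hb, integral_id]
    simp
  · exact (continuous_id.integrableOn_Icc (a := 0) (b := b)).mono_set Ioc_subset_Icc_self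
  · exact (ae_restrict_mem measurableSet_Ioc).mono fun y hy => hy.1.le

open MeasureTheory Set in
lemma volume_real_ellipticSector {A B C X Y Δ : ℝ} (hA : 0 < A)
    (hD : B ^ 2 - 4 * A * C < 0) (hXY : X ≤ Y) (hΔ : 0 ≤ Δ) :
    volume.real (ellipticSector A B C X Y Δ)
      = Δ / 2 * ∫ t in X..Y, 1 / (A * t ^ 2 + B * t + C) := by
  set q : ℝ → ℝ := fun t => A * t ^ 2 + B * t + C with hq
  have hq0 : ∀ t, 0 < q t := quadratic_pos hA hD
  have hqc : Continuous q := by fun_prop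
  set T : Set (ℝ × ℝ) := {p | p.2 ^ 2 * q p.1 ≤ Δ} with hT
  have hTm : MeasurableSet T := measurableSet_le (by fun_prop) (by fun_prop)
  have hrow : ∀ y : ℝ, volume ((fun x => (x, y)) ⁻¹' ellipticSector A B C X Y Δ)
      = (Ioi 0).indicator (fun y => ∫⁻ t in Icc X Y,
          T.indicator (fun p => ENNReal.ofReal p.2) (t, y)) y := by
    intro y
    by_cases hy : 0 < y
    · rw [indicator_of_mem (mem_Ioi.2 hy)]
      have hTy : MeasurableSet {t | (t, y) ∈ T} := measurable_prodMk_right hTm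
      have hpre : (fun x => (x, y)) ⁻¹' ellipticSector A B C X Y Δ
          = (fun x => y⁻¹ * x) ⁻¹' ({t | (t, y) ∈ T} ∩ Icc X Y) := by
        ext x
        have e : y ^ 2 * (A * (x / y) ^ 2 + B * (x / y) + C)
            = A * x ^ 2 + B * x * y + C * y ^ 2 := by field_simp
        simp only [ellipticSector, hT, hq, mem_preimage, mem_ofPred_eq, mem_inter_iff, mem_Icc,
          inv_mul_eq_div, le_div_iff₀ hy, div_le_iff₀ hy]
        rw [e]
        tauto
      rw [hpre, Real.volume_preimage_mul_left (inv_ne_zero hy.ne'), inv_inv, abs_of_pos hy,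
        ← Measure.restrict_apply hTy, ← lintegral_indicator_const hTy]
      rfl
    · rw [indicator_of_notMem (by simpa using hy)]
      convert measure_empty (μ := (volume : Measure ℝ))
      exact eq_empty_of_forall_notMem fun x hx => hy hx.1
  have hcol : ∀ t : ℝ, ∫⁻ y in Ioi 0, T.indicator (fun p => ENNReal.ofReal p.2) (t, y)
      = ENNReal.ofReal (Δ / 2 * (1 / q t)) := by
    intro t
    have hTt : MeasurableSet {y | (t, y) ∈ T} := measurable_prodMk_left hTm
    have hset : {y | (t, y) ∈ T} ∩ Ioi 0 = Ioc 0 √(Δ / q t) := by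
      ext y
      simp only [hT, mem_inter_iff, mem_ofPred_eq, mem_Ioi, mem_Ioc]
      rw [and_comm]
      refine and_congr_right fun hy => ?_
      rw [Real.le_sqrt' hy, le_div_iff₀ (hq0 t)]
    calc ∫⁻ y in Ioi 0, T.indicator (fun p => ENNReal.ofReal p.2) (t, y)
        = ∫⁻ y in Ioi 0, {y | (t, y) ∈ T}.indicator ENNReal.ofReal y := rfl
      _ = ∫⁻ y in Ioc 0 √(Δ / q t), ENNReal.ofReal y := by
          rw [lintegral_indicator hTt, Measure.restrict_restrict hTt, hset]
      _ = _ := by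
          rw [lintegral_ofReal_Ioc_zero (Real.sqrt_nonneg _),
            Real.sq_sqrt (div_nonneg hΔ (hq0 t).le)]
          congr 1
          ring
  have hlint : volume (ellipticSector A B C X Y Δ)
      = ENNReal.ofReal (∫ t in Icc X Y, Δ / 2 * (1 / q t)) := by
    rw [Measure.volume_eq_prod, Measure.prod_apply_symm (measurableSet_ellipticSector ..)]
    simp_rw [hrow]
    rw [lintegral_indicator measurableSet_Ioi, lintegral_lintegral_swap]
    · simp_rw [hcol]
      rw [ofReal_integral_eq_lintegral_ofReal]
      · refine Continuous.integrableOn_Icc ?_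
        exact continuous_const.mul (continuous_const.div hqc fun t => (hq0 t).ne')
      · exact Filter.Eventually.of_forall fun t =>
          mul_nonneg (by linarith) (one_div_nonneg.2 (hq0 t).le)
    · refine Measurable.aemeasurable ?_
      have : Measurable (T.indicator fun p => ENNReal.ofReal p.2) :=
        (ENNReal.measurable_ofReal.comp measurable_snd).indicator hTm
      exact this.comp measurable_swap
  rw [measureReal_def, hlint, ENNReal.toReal_ofReal, integral_const_mul,
    intervalIntegral.integral_of_le hXY, integral_Icc_eq_integral_Ioc]
  exact integral_nonneg fun t => mul_nonneg (by linarith) (one_div_nonneg.2 (hq0 t).le)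

lemma ncard_ellipticSector_sub_le {A B C X Y Δ : ℝ} (hA : 0 < A)
    (hD : B ^ 2 - 4 * A * C < 0) (hXY : X ≤ Y) (hΔ : 0 ≤ Δ) :
    |({p : ℤ × ℤ | ((p.1 : ℝ), (p.2 : ℝ)) ∈ ellipticSector A B C X Y Δ}.ncard : ℝ)
        - Δ / 2 * ∫ t in X..Y, 1 / (A * t ^ 2 + B * t + C)|
      ≤ 4 * √(4 * (A + C) / (4 * A * C - B ^ 2) * Δ) + 1 := by
  have hC : 0 ≤ C := by
    by_contra! hC
    nlinarith [sq_nonneg B, mul_nonneg hA.le (neg_nonneg.2 hC.le)]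
  rw [← volume_real_ellipticSector hA hD hXY hΔ]
  exact abs_ncard_lattice_sub_volume_le (measurableSet_ellipticSector ..) (Real.sqrt_nonneg _)
    (ellipticSector_subset hA hD X Y Δ) (ordConnected_ellipticSector_column hC A B X Y Δ)
    (ordConnected_ellipticSector_row hA.le B C X Y Δ)

lemma finite_lattice_ellipticSector {A B C : ℝ} (hA : 0 < A) (hD : B ^ 2 - 4 * A * C < 0)
    (X Y Δ : ℝ) :
    {p : ℤ × ℤ | ((p.1 : ℝ), (p.2 : ℝ)) ∈ ellipticSector A B C X Y Δ}.Finite := by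
  set R := √(4 * (A + C) / (4 * A * C - B ^ 2) * Δ)
  refine ((Set.finite_Icc ⌈-R⌉ ⌊R⌋).prod (Set.finite_Icc ⌈-R⌉ ⌊R⌋)).subset fun p hp => ?_
  rw [← Int.preimage_Icc]
  exact ellipticSector_subset hA hD X Y Δ hp

/-- Scaling: the lattice points of a sector divisible by `d` correspond to the lattice points
of the sector shrunk by `d`. -/
lemma ncard_dvd_gcd_ellipticSector (A B C X Y Δ : ℝ) {d : ℕ} (hd : 1 ≤ d) :
    {p : ℤ × ℤ | ((p.1 : ℝ), (p.2 : ℝ)) ∈ ellipticSector A B C X Y Δ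
        ∧ d ∣ Int.gcd p.1 p.2}.ncard
      = {p : ℤ × ℤ | ((p.1 : ℝ), (p.2 : ℝ)) ∈ ellipticSector A B C X Y (Δ / d ^ 2)}.ncard := by
  have hd0 : (0 : ℝ) < d := by exact_mod_cast hd
  have hinj : Function.Injective fun p : ℤ × ℤ => ((d : ℤ) * p.1, (d : ℤ) * p.2) := by
    rintro ⟨a, b⟩ ⟨a', b'⟩ h
    simpa [Nat.one_le_iff_ne_zero.1 hd] using h
  have hmem : ∀ m n : ℤ,
      ((((d : ℤ) * m : ℤ) : ℝ), (((d : ℤ) * n : ℤ) : ℝ)) ∈ ellipticSector A B C X Y Δ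
        ↔ ((m : ℝ), (n : ℝ)) ∈ ellipticSector A B C X Y (Δ / d ^ 2) := by
    intro m n
    simp only [ellipticSector, Set.mem_ofPred_eq]
    push_cast
    have e1 : X * ((d : ℝ) * n) = d * (X * n) := by ring
    have e2 : Y * ((d : ℝ) * n) = d * (Y * n) := by ring
    have e3 : A * ((d : ℝ) * m) ^ 2 + B * (d * m) * (d * n) + C * (d * n) ^ 2
        = (A * (m : ℝ) ^ 2 + B * m * n + C * n ^ 2) * d ^ 2 := by ring
    rw [e1, e2, e3, mul_pos_iff_of_pos_left hd0, mul_le_mul_iff_right₀ hd0,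
      mul_le_mul_iff_right₀ hd0, le_div_iff₀ (by positivity)]
  rw [← Set.ncard_image_of_injective
    {p : ℤ × ℤ | ((p.1 : ℝ), (p.2 : ℝ)) ∈ ellipticSector A B C X Y (Δ / d ^ 2)} hinj]
  congr 1
  ext ⟨m, n⟩
  simp only [Set.mem_ofPred_eq, Set.mem_image, Prod.exists, Prod.mk.injEq]
  constructor
  · rintro ⟨h, hdvd⟩
    obtain ⟨a, rfl⟩ := (Int.natCast_dvd_natCast.2 hdvd).trans (Int.gcd_dvd_left m n)
    obtain ⟨b, rfl⟩ := (Int.natCast_dvd_natCast.2 hdvd).trans (Int.gcd_dvd_right _ n)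
    exact ⟨a, b, (hmem a b).1 h, rfl, rfl⟩
  · rintro ⟨a, b, h, hm, hn⟩
    rw [← hm, ← hn]
    exact ⟨(hmem a b).2 h,
      Int.natCast_dvd_natCast.1 (Int.dvd_coe_gcd (dvd_mul_right _ _) (dvd_mul_right _ _))⟩

open ArithmeticFunction in
/-- The count of coprime lattice points in a sector, with error term `O(R log R)`, where `R`
is the radius of a box containing the sector. -/
lemma abs_ncard_coprime_ellipticSector_sub_le {A B C X Y Δ R κ : ℝ} (hA : 0 < A)
    (hD : B ^ 2 - 4 * A * C < 0) (hXY : X ≤ Y) (hΔ : 0 < Δ)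
    (hκ : κ = 4 * (A + C) / (4 * A * C - B ^ 2)) (hR : R = √(κ * Δ)) (hR1 : 1 ≤ R) :
    |({p : ℤ × ℤ | ((p.1 : ℝ), (p.2 : ℝ)) ∈ ellipticSector A B C X Y Δ
          ∧ Int.gcd p.1 p.2 = 1}.ncard : ℝ)
        - 3 * Δ / π ^ 2 * ∫ t in X..Y, 1 / (A * t ^ 2 + B * t + C)|
      ≤ 5 * R * (1 + Real.log R)
        + |∫ t in X..Y, 1 / (A * t ^ 2 + B * t + C)| * Δ / R := by
  set J := ∫ t in X..Y, 1 / (A * t ^ 2 + B * t + C) with hJ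
  have hR0 : 0 < R := by linarith
  set K := ⌊R⌋₊ with hK
  set P := (finite_lattice_ellipticSector hA hD X Y Δ).toFinset with hP
  have memP : ∀ p : ℤ × ℤ, p ∈ P ↔ ((p.1 : ℝ), (p.2 : ℝ)) ∈ ellipticSector A B C X Y Δ := by
    intro p; rw [hP, Set.Finite.mem_toFinset]; rfl
  have hgcd : ∀ p ∈ P, Int.gcd p.1 p.2 ∈ Finset.Icc 1 K := by
    intro p hp
    rw [memP] at hp
    have hpos : 0 < p.2 := Int.cast_pos.1 hp.1
    have hle : (p.2 : ℝ) ≤ R := by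
      rw [hR, hκ]
      exact (ellipticSector_subset hA hD X Y Δ hp).2.2
    rw [Finset.mem_Icc]
    refine ⟨Int.gcd_pos_of_ne_zero_right _ hpos.ne', Nat.le_floor ?_⟩
    have : (Int.gcd p.1 p.2 : ℤ) ≤ p.2 := Int.le_of_dvd hpos (Int.gcd_dvd_right ..)
    have h2 : ((Int.gcd p.1 p.2 : ℤ) : ℝ) ≤ p.2 := by exact_mod_cast this
    exact le_trans (by exact_mod_cast h2) hle
  have hcard : ∀ (Q : ℤ × ℤ → Prop) [DecidablePred Q], (P.filter Q).card
      = {p : ℤ × ℤ | ((p.1 : ℝ), (p.2 : ℝ)) ∈ ellipticSector A B C X Y Δ ∧ Q p}.ncard := by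
    intro Q _
    rw [← Set.ncard_coe_finset]
    congr 1
    ext p
    simp [memP]
  have hmob := card_filter_gcd_eq_one P K hgcd
  simp_rw [hcard] at hmob
  rw [hmob]
  have hterm : ∀ d ∈ Finset.Icc 1 K,
      |(moebius d : ℝ) * ({p : ℤ × ℤ | ((p.1 : ℝ), (p.2 : ℝ)) ∈ ellipticSector A B C X Y Δ
          ∧ d ∣ Int.gcd p.1 p.2}.ncard : ℝ) - Δ / 2 * J * ((moebius d : ℝ) / d ^ 2)|
        ≤ 5 * R * (d : ℝ)⁻¹ := by
    intro d hd
    rw [Finset.mem_Icc] at hd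
    have hd0 : (0 : ℝ) < d := by exact_mod_cast hd.1
    have hdR : (d : ℝ) ≤ R := (Nat.cast_le.2 hd.2).trans (Nat.floor_le hR0.le)
    rw [ncard_dvd_gcd_ellipticSector A B C X Y Δ hd.1]
    have h := ncard_ellipticSector_sub_le hA hD hXY (Δ := Δ / d ^ 2) (by positivity)
    rw [← hκ, ← hJ, ← mul_div_assoc, Real.sqrt_div' _ (by positivity), Real.sqrt_sq hd0.le,
      ← hR] at h
    have hmu : |(moebius d : ℝ)| ≤ 1 := by exact_mod_cast abs_moebius_le_one
    have h1 : 1 ≤ R / d := (one_le_div hd0).2 hdR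
    have e : ∀ N : ℝ, (moebius d : ℝ) * N - Δ / 2 * J * ((moebius d : ℝ) / d ^ 2)
        = moebius d * (N - Δ / d ^ 2 / 2 * J) := fun N => by ring
    rw [e, abs_mul]
    refine (mul_le_of_le_one_left (abs_nonneg _) hmu).trans (h.trans ?_)
    rw [mul_assoc, ← div_eq_mul_inv]
    linarith
  have hsum : |∑ d ∈ Finset.Icc 1 K, (moebius d : ℝ)
        * ({p : ℤ × ℤ | ((p.1 : ℝ), (p.2 : ℝ)) ∈ ellipticSector A B C X Y Δ
          ∧ d ∣ Int.gcd p.1 p.2}.ncard : ℝ)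
      - Δ / 2 * J * ∑ d ∈ Finset.Icc 1 K, (moebius d : ℝ) / d ^ 2|
      ≤ 5 * R * (1 + Real.log R) := by
    rw [Finset.mul_sum, ← Finset.sum_sub_distrib]
    refine (Finset.abs_sum_le_sum_abs _ _).trans ((Finset.sum_le_sum hterm).trans ?_)
    rw [← Finset.mul_sum]
    refine mul_le_mul_of_nonneg_left ?_ (by positivity)
    have h := harmonic_floor_le_one_add_log R hR1
    rw [harmonic_eq_sum_Icc] at h
    push_cast at h
    exact h
  have htail : |Δ / 2 * J * ∑ d ∈ Finset.Icc 1 K, (moebius d : ℝ) / d ^ 2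
      - 3 * Δ / π ^ 2 * J| ≤ |J| * Δ / R := by
    have e : Δ / 2 * J * ∑ d ∈ Finset.Icc 1 K, (moebius d : ℝ) / d ^ 2 - 3 * Δ / π ^ 2 * J
        = Δ / 2 * J * (∑ d ∈ Finset.Icc 1 K, (moebius d : ℝ) / d ^ 2 - 6 / π ^ 2) := by ring
    have h1 := abs_sum_moebius_div_sq_sub_le K
    have h2 : 2 / ((K : ℝ) + 1) ≤ 2 / R :=
      div_le_div_of_nonneg_left (by norm_num) hR0 (Nat.lt_floor_add_one R).le
    rw [e, abs_mul, abs_mul, abs_of_pos (by positivity : 0 < Δ / 2)]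
    calc Δ / 2 * |J| * _ ≤ Δ / 2 * |J| * (2 / R) :=
          mul_le_mul_of_nonneg_left (h1.trans h2) (by positivity)
      _ = |J| * Δ / R := by ring
  exact (abs_sub_le _ _ _).trans (add_le_add hsum htail)

/-- For `A > 0`, `D = B² - 4AC < 0`, and any interval `[X,Y]`, the number of coprime
pairs `(m,n)`, `n ≥ 1`, with `X ≤ m/n ≤ Y` and `Am² + Bmn + Cn² ≤ Δ` is
`(3Δ/π²)(2/√(-D))[arctan((2At+B)/√(-D))]_{t=X}^{t=Y} + O(Δ^{1/2+ε})`. -/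
theorem equid_count_A_pos_D_neg (A B C X Y : ℝ) (hA : 0 < A)
    (hD : B ^ 2 - 4 * A * C < 0) (hXY : X ≤ Y) (ε : ℝ) (hε : 0 < ε) :
    ∃ c : ℝ, 0 < c ∧ ∃ Δ₀ : ℝ, ∀ Δ : ℝ, Δ₀ ≤ Δ →
      abs (({p : ℤ × ℤ | 1 ≤ p.2 ∧ Int.gcd p.1 p.2 = 1 ∧
            X ≤ (p.1 : ℝ) / (p.2 : ℝ) ∧ (p.1 : ℝ) / (p.2 : ℝ) ≤ Y ∧
            A * (p.1 : ℝ) ^ 2 + B * (p.1 : ℝ) * (p.2 : ℝ) + C * (p.2 : ℝ) ^ 2 ≤ Δ}.ncard : ℝ) -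
          3 * Δ / π ^ 2 * (2 / Real.sqrt (-(B ^ 2 - 4 * A * C))) *
            (Real.arctan ((2 * A * Y + B) / Real.sqrt (-(B ^ 2 - 4 * A * C))) -
              Real.arctan ((2 * A * X + B) / Real.sqrt (-(B ^ 2 - 4 * A * C))))) ≤
        c * Δ ^ ((1 : ℝ) / 2 + ε) := by
  set J := ∫ t in X..Y, 1 / (A * t ^ 2 + B * t + C) with hJ
  have hC : 0 < C := by
    by_contra! hC
    nlinarith [sq_nonneg B, mul_nonneg hA.le (neg_nonneg.2 hC)]
  have hD' : 0 < 4 * A * C - B ^ 2 := by linarith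
  obtain ⟨κ, hκ⟩ : ∃ κ, κ = 4 * (A + C) / (4 * A * C - B ^ 2) := ⟨_, rfl⟩
  have hκ0 : 0 < κ := by rw [hκ]; positivity
  refine ⟨(5 * (1 + 1 / (2 * ε)) + |J| / κ) * κ ^ ((1 : ℝ) / 2 + ε), by positivity, 1 / κ,
    fun Δ hΔ => ?_⟩
  have hΔ0 : 0 < Δ := (one_div_pos.2 hκ0).trans_le hΔ
  have hκΔ : 1 ≤ κ * Δ := by
    rw [div_le_iff₀ hκ0] at hΔ
    linarith
  obtain ⟨R, hR⟩ : ∃ R, R = √(κ * Δ) := ⟨_, rfl⟩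
  have hR1 : 1 ≤ R := hR ▸ Real.one_le_sqrt.2 hκΔ
  have hR0 : 0 < R := by linarith
  have hRsq : R ^ 2 = κ * Δ := by rw [hR, Real.sq_sqrt (by linarith)]
  have hset : {p : ℤ × ℤ | 1 ≤ p.2 ∧ Int.gcd p.1 p.2 = 1 ∧
      X ≤ (p.1 : ℝ) / (p.2 : ℝ) ∧ (p.1 : ℝ) / (p.2 : ℝ) ≤ Y ∧
      A * (p.1 : ℝ) ^ 2 + B * (p.1 : ℝ) * (p.2 : ℝ) + C * (p.2 : ℝ) ^ 2 ≤ Δ}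
      = {p : ℤ × ℤ | ((p.1 : ℝ), (p.2 : ℝ)) ∈ ellipticSector A B C X Y Δ
          ∧ Int.gcd p.1 p.2 = 1} := by
    ext ⟨m, n⟩
    simp only [ellipticSector, Set.mem_ofPred_eq]
    by_cases hn : 1 ≤ n
    · have hn0 : (0 : ℝ) < n := by exact_mod_cast hn
      rw [le_div_iff₀ hn0, div_le_iff₀ hn0]
      tauto
    · have hn0 : ¬ (0 : ℝ) < n := by
        intro h
        exact hn (by exact_mod_cast h)
      tauto
  have hmain := abs_ncard_coprime_ellipticSector_sub_le hA hD hXY hΔ0 hκ hR hR1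
  rw [hset, mul_assoc (3 * Δ / π ^ 2), ← integral_one_div_quadratic hA hD]
  refine hmain.trans ?_
  have hpow : R ^ (2 * ε) = (κ * Δ) ^ ε := by
    rw [← hRsq, ← Real.rpow_natCast_mul hR0.le]
    norm_num
  have hone : 1 ≤ R ^ (2 * ε) := Real.one_le_rpow hR1 (by positivity)
  have hlog : Real.log R ≤ R ^ (2 * ε) / (2 * ε) :=
    Real.log_le_rpow_div hR0.le (by positivity)
  have hΔR : |J| * Δ / R = |J| / κ * R := by
    rw [show Δ = R ^ 2 / κ by rw [hRsq]; field_simp]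
    field_simp
  have htarget : κ ^ ((1 : ℝ) / 2 + ε) * Δ ^ ((1 : ℝ) / 2 + ε) = R * R ^ (2 * ε) := by
    rw [← Real.mul_rpow hκ0.le hΔ0.le, Real.rpow_add (by positivity), hpow, hR,
      Real.sqrt_eq_rpow]
  rw [mul_assoc _ (κ ^ _), htarget, ← hJ, hΔR]
  calc 5 * R * (1 + Real.log R) + |J| / κ * R
      ≤ 5 * R * (R ^ (2 * ε) + R ^ (2 * ε) / (2 * ε)) + |J| / κ * R * R ^ (2 * ε) := by
        refine add_le_add (mul_le_mul_of_nonneg_left (add_le_add hone hlog) (by positivity)) ?_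
        exact le_mul_of_one_le_right (by positivity) hone
    _ = _ := by ring
end
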